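/- Let n be a nonnegative integer, let μ ∈ ℂ satisfy 2μ + t ≠ 0 for every integer t with 0 ≤ t ≤ 2n, and let c ∈ ℂ. Then Σ_{ℓ=0}^{n} ((2μ+2ℓ)/((2μ)_{n+ℓ+1} · (n−ℓ)!)) · C_ℓ^{(μ)}(c) = (2^n · (μ)_n / ((2μ)_{2n} · n!)) · (1+c)^n. -/

import Mathlib

open scoped BigOperators

noncomputable section

/-- Ascending Pochhammer symbol `(a)_n = a (a+1) ⋯ (a+n-1)`. -/
def aP (n : ℕ) (a : ℂ) : ℂ := (ascPochhammer ℂ n).eval a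

/-- The Gegenbauer polynomial
`C_ℓ^{(μ)}(x) = ∑_{k=0}^{⌊ℓ/2⌋} (-1)^k ((μ)_{ℓ-k} / (k! (ℓ-2k)!)) (2x)^{ℓ-2k}`. -/
def gegenbauerC (μ : ℂ) (ℓ : ℕ) (x : ℂ) : ℂ :=
  ∑ k ∈ Finset.range (ℓ / 2 + 1),
    (-1) ^ k * aP (ℓ - k) μ / ((k.factorial : ℂ) * ((ℓ - 2 * k).factorial : ℂ)) *
      (2 * x) ^ (ℓ - 2 * k)

theorem aP_zero (a : ℂ) : aP 0 a = 1 := by simp [aP]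

theorem aP_succ (n : ℕ) (a : ℂ) : aP (n + 1) a = aP n a * (a + n) := by
  simp [aP, ascPochhammer_succ_eval]

theorem aP_ne_zero {n : ℕ} {a : ℂ} (h : ∀ t < n, a + (t : ℂ) ≠ 0) : aP n a ≠ 0 := by
  induction n with
  | zero => simp [aP_zero]
  | succ n ih =>
    rw [aP_succ]
    exact mul_ne_zero (ih fun t ht => h t (by omega)) (h n (by omega))

/-- The `k`-th term of the Gegenbauer polynomial of degree `ℓ`, extended by zero. -/
def gegenbauerTerm (μ : ℂ) (x : ℂ) (ℓ k : ℕ) : ℂ :=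
  if 2 * k ≤ ℓ then
    (-1) ^ k * aP (ℓ - k) μ / ((k.factorial : ℂ) * ((ℓ - 2 * k).factorial : ℂ)) *
      (2 * x) ^ (ℓ - 2 * k)
  else 0

theorem gegenbauerTerm_of_lt (μ x : ℂ) {ℓ k : ℕ} (h : ℓ < 2 * k) :
    gegenbauerTerm μ x ℓ k = 0 := if_neg (by omega)

theorem gegenbauerTerm_add (μ x : ℂ) (k p : ℕ) :
    gegenbauerTerm μ x (2 * k + p) k =
      (-1) ^ k * aP (k + p) μ / ((k.factorial : ℂ) * (p.factorial : ℂ)) * (2 * x) ^ p := by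
  rw [gegenbauerTerm, if_pos (by omega), show 2 * k + p - k = k + p by omega,
    show 2 * k + p - 2 * k = p by omega]

theorem gegenbauerC_eq_sum_term (μ x : ℂ) {ℓ N : ℕ} (h : ℓ / 2 < N) :
    gegenbauerC μ ℓ x = ∑ k ∈ Finset.range N, gegenbauerTerm μ x ℓ k := by
  rw [← Finset.sum_subset (Finset.range_mono (show ℓ / 2 + 1 ≤ N from h))]
  · refine Finset.sum_congr rfl fun k hk => ?_
    rw [Finset.mem_range] at hk
    rw [gegenbauerTerm, if_pos (by omega)]
  · intro k _ hk
    rw [Finset.mem_range] at hk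
    exact gegenbauerTerm_of_lt μ x (by omega)

theorem gegenbauerTerm_zero_recurrence (μ x : ℂ) (ℓ : ℕ) :
    (ℓ + 1 : ℂ) * gegenbauerTerm μ x (ℓ + 1) 0 = 2 * (ℓ + μ) * x * gegenbauerTerm μ x ℓ 0 := by
  have h1 := gegenbauerTerm_add μ x 0 ℓ
  have h2 := gegenbauerTerm_add μ x 0 (ℓ + 1)
  simp only [mul_zero, zero_add] at h1 h2
  rw [h1, h2, aP_succ, Nat.factorial_succ]
  have h3 : (ℓ.factorial : ℂ) ≠ 0 := by exact_mod_cast ℓ.factorial_ne_zero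
  have h4 : (ℓ + 1 : ℂ) ≠ 0 := by exact_mod_cast ℓ.succ_ne_zero
  push_cast
  field_simp
  ring

theorem gegenbauerTerm_succ_recurrence (μ x : ℂ) (ℓ k : ℕ) :
    (ℓ + 2 : ℂ) * gegenbauerTerm μ x (ℓ + 2) (k + 1) =
      2 * (ℓ + 1 + μ) * x * gegenbauerTerm μ x (ℓ + 1) (k + 1) -
        (ℓ + 2 * μ) * gegenbauerTerm μ x ℓ k := by
  have hk : (k.factorial : ℂ) ≠ 0 := by exact_mod_cast k.factorial_ne_zero
  have hk' : (k + 1 : ℂ) ≠ 0 := by exact_mod_cast k.succ_ne_zero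
  rcases lt_trichotomy ℓ (2 * k) with h | rfl | h
  · rw [gegenbauerTerm_of_lt μ x h, gegenbauerTerm_of_lt μ x (show ℓ + 1 < 2 * (k + 1) by omega),
      gegenbauerTerm_of_lt μ x (show ℓ + 2 < 2 * (k + 1) by omega)]
    ring
  · have h1 := gegenbauerTerm_add μ x (k + 1) 0
    have h2 := gegenbauerTerm_add μ x k 0
    rw [add_zero, mul_add, mul_one] at h1
    rw [add_zero] at h2
    rw [h1, h2, gegenbauerTerm_of_lt μ x (show 2 * k + 1 < 2 * (k + 1) by omega), add_zero,
      add_zero, aP_succ, Nat.factorial_succ]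
    push_cast
    field_simp
    ring
  · obtain ⟨p, rfl⟩ := Nat.exists_eq_add_of_lt h
    have hp : (p.factorial : ℂ) ≠ 0 := by exact_mod_cast p.factorial_ne_zero
    have hp' : (p + 1 : ℂ) ≠ 0 := by exact_mod_cast p.succ_ne_zero
    rw [show 2 * k + p + 1 + 2 = 2 * (k + 1) + (p + 1) by ring,
      show 2 * k + p + 1 + 1 = 2 * (k + 1) + p by ring,
      show 2 * k + p + 1 = 2 * k + (p + 1) by ring, gegenbauerTerm_add, gegenbauerTerm_add,
      gegenbauerTerm_add, show k + 1 + (p + 1) = k + p + 1 + 1 by ring,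
      show k + 1 + p = k + p + 1 by ring, show k + (p + 1) = k + p + 1 by ring,
      aP_succ (k + p + 1), Nat.factorial_succ, Nat.factorial_succ]
    push_cast
    field_simp
    ring

/-- The three-term recurrence of the Gegenbauer polynomials. -/
theorem gegenbauerC_recurrence (μ x : ℂ) (ℓ : ℕ) :
    (ℓ + 2 : ℂ) * gegenbauerC μ (ℓ + 2) x =
      2 * (ℓ + 1 + μ) * x * gegenbauerC μ (ℓ + 1) x - (ℓ + 2 * μ) * gegenbauerC μ ℓ x := by
  rw [gegenbauerC_eq_sum_term μ x (show (ℓ + 2) / 2 < ℓ + 2 by omega),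
    gegenbauerC_eq_sum_term μ x (show (ℓ + 1) / 2 < ℓ + 2 by omega),
    gegenbauerC_eq_sum_term μ x (show ℓ / 2 < ℓ + 1 by omega), Finset.sum_range_succ',
    Finset.sum_range_succ' _ (ℓ + 1), mul_add, mul_add, Finset.mul_sum, Finset.mul_sum,
    Finset.mul_sum, Finset.sum_congr rfl fun k _ => gegenbauerTerm_succ_recurrence μ x ℓ k,
    Finset.sum_sub_distrib]
  have h := gegenbauerTerm_zero_recurrence μ x (ℓ + 1)
  push_cast at h
  linear_combination h

theorem gegenbauerC_zero (μ x : ℂ) : gegenbauerC μ 0 x = 1 := by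
  simp [gegenbauerC, aP_zero]

theorem gegenbauerC_one (μ x : ℂ) : gegenbauerC μ 1 x = 2 * μ * x := by
  simp [gegenbauerC, aP_succ, aP_zero]
  ring

/-- The coefficient `1 / ((2μ)_{n+ℓ+1} (n-ℓ)!)`, extended by zero to `ℓ > n`. -/
def gegenbauerWeight (μ : ℂ) (n ℓ : ℕ) : ℂ :=
  (n.descFactorial ℓ : ℂ) / (aP (n + ℓ + 1) (2 * μ) * (n.factorial : ℂ))

theorem gegenbauerWeight_of_lt (μ : ℂ) {n ℓ : ℕ} (h : n < ℓ) : gegenbauerWeight μ n ℓ = 0 := by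
  simp [gegenbauerWeight, Nat.descFactorial_of_lt h]

theorem gegenbauerWeight_of_le (μ : ℂ) {n ℓ : ℕ} (h : ℓ ≤ n) :
    gegenbauerWeight μ n ℓ = 1 / (aP (n + ℓ + 1) (2 * μ) * ((n - ℓ).factorial : ℂ)) := by
  have h1 : ((n - ℓ).factorial : ℂ) ≠ 0 := by exact_mod_cast (n - ℓ).factorial_ne_zero
  have h2 : (n.descFactorial ℓ : ℂ) ≠ 0 := by
    exact_mod_cast (Nat.descFactorial_eq_zero_iff_lt.not.mpr (by omega))
  rw [gegenbauerWeight, ← Nat.factorial_mul_descFactorial h]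
  push_cast
  rw [← mul_assoc, div_mul_cancel_right₀ h2, one_div]

theorem cast_descFactorial_succ (n ℓ : ℕ) :
    (n.descFactorial (ℓ + 1) : ℂ) = (n - ℓ) * n.descFactorial ℓ := by
  rcases le_or_gt ℓ n with h | h
  · rw [Nat.descFactorial_succ]
    push_cast [h]
    ring
  · simp [Nat.descFactorial_of_lt h]

theorem gegenbauerWeight_succ_right {μ : ℂ} {n ℓ : ℕ} (h : 2 * μ + ((n + ℓ + 1 : ℕ) : ℂ) ≠ 0) :
    (2 * μ + n + ℓ + 1) * gegenbauerWeight μ n (ℓ + 1) = (n - ℓ) * gegenbauerWeight μ n ℓ := by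
  rw [gegenbauerWeight, gegenbauerWeight, cast_descFactorial_succ,
    show n + (ℓ + 1) + 1 = n + ℓ + 1 + 1 by ring, aP_succ (n + ℓ + 1)]
  have h' : 2 * μ + n + ℓ + 1 ≠ 0 := by
    push_cast at h
    convert h using 1
    ring
  rw [show 2 * μ + ((n + ℓ + 1 : ℕ) : ℂ) = 2 * μ + n + ℓ + 1 by push_cast; ring]
  field_simp

theorem gegenbauerWeight_eq_succ_left {μ : ℂ} {n ℓ : ℕ}
    (h : 2 * μ + ((n + ℓ + 1 : ℕ) : ℂ) ≠ 0) :
    gegenbauerWeight μ n ℓ =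
      (n + 1 - ℓ) * (2 * μ + n + ℓ + 1) * gegenbauerWeight μ (n + 1) ℓ := by
  have hd : (n + 1 - ℓ : ℂ) * (n + 1).descFactorial ℓ = (n + 1) * n.descFactorial ℓ := by
    have := cast_descFactorial_succ (n + 1) ℓ
    rw [Nat.succ_descFactorial_succ] at this
    push_cast at this
    exact this.symm
  have hn : (n + 1 : ℂ) ≠ 0 := by exact_mod_cast n.succ_ne_zero
  have hn' : (n.factorial : ℂ) ≠ 0 := by exact_mod_cast n.factorial_ne_zero
  have e : 2 * μ + ((n + ℓ + 1 : ℕ) : ℂ) = 2 * μ + n + ℓ + 1 := by push_cast; ring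
  rw [e] at h
  rw [gegenbauerWeight, gegenbauerWeight, show n + 1 + ℓ + 1 = n + ℓ + 1 + 1 by ring,
    aP_succ (n + ℓ + 1), e, Nat.factorial_succ]
  push_cast
  rcases eq_or_ne (aP (n + ℓ + 1) (2 * μ)) 0 with hA | hA
  · simp [hA]
  · field_simp
    linear_combination -hd

theorem gegenbauerWeight_succ_right_eq_succ_left {μ : ℂ} {n ℓ : ℕ}
    (h : 2 * μ + ((n + ℓ + 1 : ℕ) : ℂ) ≠ 0) :
    gegenbauerWeight μ n (ℓ + 1) = (n - ℓ) * (n + 1 - ℓ) * gegenbauerWeight μ (n + 1) ℓ := by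
  have h1 := gegenbauerWeight_succ_right h
  rw [gegenbauerWeight_eq_succ_left h] at h1
  have e : 2 * μ + ((n + ℓ + 1 : ℕ) : ℂ) = 2 * μ + n + ℓ + 1 := by push_cast; ring
  rw [e] at h
  refine mul_left_cancel₀ h ?_
  linear_combination h1

theorem gegenbauerWeight_eq_succ_succ {μ : ℂ} {n ℓ : ℕ}
    (h : 2 * μ + ((n + ℓ + 1 : ℕ) : ℂ) ≠ 0) (h' : 2 * μ + ((n + ℓ + 2 : ℕ) : ℂ) ≠ 0) :
    gegenbauerWeight μ n ℓ =
      (2 * μ + n + ℓ + 1) * (2 * μ + n + ℓ + 2) * gegenbauerWeight μ (n + 1) (ℓ + 1) := by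
  have hn : (n + 1 : ℂ) ≠ 0 := by exact_mod_cast n.succ_ne_zero
  have hn' : (n.factorial : ℂ) ≠ 0 := by exact_mod_cast n.factorial_ne_zero
  have e : 2 * μ + ((n + ℓ + 1 : ℕ) : ℂ) = 2 * μ + n + ℓ + 1 := by push_cast; ring
  have e' : 2 * μ + ((n + ℓ + 1 + 1 : ℕ) : ℂ) = 2 * μ + n + ℓ + 2 := by push_cast; ring
  rw [e] at h
  rw [show n + ℓ + 2 = n + ℓ + 1 + 1 by ring, e'] at h'
  rw [gegenbauerWeight, gegenbauerWeight, show n + 1 + (ℓ + 1) + 1 = n + ℓ + 1 + 1 + 1 by ring,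
    aP_succ (n + ℓ + 1 + 1), aP_succ (n + ℓ + 1), e, e', Nat.factorial_succ,
    Nat.succ_descFactorial_succ]
  push_cast
  field_simp

/-- The partial sums of the difference of the two sides of
`gegenbauer_weighted_sum_succ` telescope. -/
theorem gegenbauer_partial_sum {n : ℕ} {μ : ℂ}
    (hμ : ∀ t : ℕ, t ≤ 2 * (n + 1) → 2 * μ + (t : ℂ) ≠ 0) (c : ℂ) {m : ℕ} (hm : m ≤ n + 1) :
    ∑ ℓ ∈ Finset.range (m + 1), (2 * μ + 2 * ℓ) *
        ((2 * μ + 2 * n + 1) * (n + 1) * gegenbauerWeight μ (n + 1) ℓ -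
          (1 + c) * gegenbauerWeight μ n ℓ) * gegenbauerC μ ℓ c =
      (m + 2 * μ) * gegenbauerWeight μ n (m + 1) * gegenbauerC μ m c -
        (m + 1) * gegenbauerWeight μ n m * gegenbauerC μ (m + 1) c := by
  induction m with
  | zero =>
    have h : 2 * μ + ((n + 0 + 1 : ℕ) : ℂ) ≠ 0 := hμ _ (by omega)
    have h1 := gegenbauerWeight_eq_succ_left (ℓ := 0) h
    have h2 := gegenbauerWeight_succ_right_eq_succ_left (ℓ := 0) h
    simp only [zero_add, Finset.sum_range_one, gegenbauerC_zero, gegenbauerC_one] at *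
    rw [h1, h2]
    push_cast
    ring
  | succ m ih =>
    rw [Finset.sum_range_succ, ih (by omega)]
    have h0 : 2 * μ + ((n + m + 1 : ℕ) : ℂ) ≠ 0 := hμ _ (by omega)
    have h : 2 * μ + ((n + m + 2 : ℕ) : ℂ) ≠ 0 := hμ _ (by omega)
    have h' : 2 * μ + ((n + (m + 1) + 1 : ℕ) : ℂ) ≠ 0 := h
    have h1 := gegenbauerWeight_eq_succ_left h'
    have h2 := gegenbauerWeight_succ_right_eq_succ_left h'
    have h3 := gegenbauerWeight_eq_succ_succ h0 h
    have hr := gegenbauerC_recurrence μ c m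
    rw [h1, h2, h3]
    push_cast
    linear_combination (n - m : ℂ) * (2 * μ + n + m + 2) *
      gegenbauerWeight μ (n + 1) (m + 1) * hr

theorem gegenbauer_weighted_sum_succ {n : ℕ} {μ : ℂ}
    (hμ : ∀ t : ℕ, t ≤ 2 * (n + 1) → 2 * μ + (t : ℂ) ≠ 0) (c : ℂ) :
    (2 * μ + 2 * n + 1) * (n + 1) * ∑ ℓ ∈ Finset.range (n + 1 + 1),
        (2 * μ + 2 * ℓ) * gegenbauerWeight μ (n + 1) ℓ * gegenbauerC μ ℓ c =
      (1 + c) * ∑ ℓ ∈ Finset.range (n + 1),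
        (2 * μ + 2 * ℓ) * gegenbauerWeight μ n ℓ * gegenbauerC μ ℓ c := by
  have h := gegenbauer_partial_sum hμ c le_rfl
  rw [gegenbauerWeight_of_lt μ (show n < n + 1 by omega),
    gegenbauerWeight_of_lt μ (show n < n + 1 + 1 by omega)] at h
  have e : ∑ ℓ ∈ Finset.range (n + 1),
        (2 * μ + 2 * ℓ) * gegenbauerWeight μ n ℓ * gegenbauerC μ ℓ c =
      ∑ ℓ ∈ Finset.range (n + 1 + 1),
        (2 * μ + 2 * ℓ) * gegenbauerWeight μ n ℓ * gegenbauerC μ ℓ c := by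
    rw [Finset.sum_range_succ _ (n + 1), gegenbauerWeight_of_lt μ (show n < n + 1 by omega)]
    ring
  rw [e, Finset.mul_sum, Finset.mul_sum, ← sub_eq_zero, ← Finset.sum_sub_distrib]
  refine (Finset.sum_congr rfl fun ℓ _ => ?_).trans (h.trans (by ring))
  ring

theorem gegenbauer_weighted_sum (n : ℕ) (μ : ℂ)
    (hμ : ∀ t : ℕ, t ≤ 2 * n → 2 * μ + (t : ℂ) ≠ 0) (c : ℂ) :
    ∑ ℓ ∈ Finset.range (n + 1),
        (2 * μ + 2 * ℓ) * gegenbauerWeight μ n ℓ * gegenbauerC μ ℓ c =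
      2 ^ n * aP n μ / (aP (2 * n) (2 * μ) * (n.factorial : ℂ)) * (1 + c) ^ n := by
  induction n with
  | zero =>
    have h : 2 * μ ≠ 0 := by simpa using hμ 0 le_rfl
    have h' : μ ≠ 0 := right_ne_zero_of_mul h
    simp [gegenbauerWeight, gegenbauerC_zero, aP_succ, aP_zero]
    field_simp
  | succ n ih =>
    have hn : (n + 1 : ℂ) ≠ 0 := by exact_mod_cast n.succ_ne_zero
    have hn' : (n.factorial : ℂ) ≠ 0 := by exact_mod_cast n.factorial_ne_zero
    have ha : aP (2 * n) (2 * μ) ≠ 0 := aP_ne_zero fun t ht => hμ t (by omega)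
    have h0 := hμ (2 * n) (by omega)
    have h1 := hμ (2 * n + 1) (by omega)
    push_cast at h0 h1
    rw [← add_assoc] at h1
    have h0' : μ + n ≠ 0 := fun h => h0 (by linear_combination 2 * h)
    have h := gegenbauer_weighted_sum_succ hμ c
    rw [ih fun t ht => hμ t (by omega)] at h
    refine mul_left_cancel₀ (mul_ne_zero h1 hn) (h.trans ?_)
    rw [show 2 * (n + 1) = 2 * n + 1 + 1 by ring, aP_succ (2 * n + 1), aP_succ (2 * n),
      aP_succ n, Nat.factorial_succ]
    push_cast
    rw [show 2 * μ + 2 * (n : ℂ) = 2 * (μ + n) by ring, ← add_assoc] at *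
    field_simp
    ring

/-- A summation formula for the Gegenbauer polynomials. -/
theorem gegenbauer_summation (n : ℕ) (μ : ℂ)
    (hμ : ∀ t : ℕ, t ≤ 2 * n → 2 * μ + (t : ℂ) ≠ 0) (c : ℂ) :
    ∑ ℓ ∈ Finset.range (n + 1),
        (2 * μ + 2 * ℓ) / (aP (n + ℓ + 1) (2 * μ) * ((n - ℓ).factorial : ℂ)) *
          gegenbauerC μ ℓ c =
      2 ^ n * aP n μ / (aP (2 * n) (2 * μ) * (n.factorial : ℂ)) * (1 + c) ^ n := by
  rw [← gegenbauer_weighted_sum n μ hμ c]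
  refine Finset.sum_congr rfl fun ℓ hℓ => ?_
  rw [Finset.mem_range] at hℓ
  rw [gegenbauerWeight_of_le μ (show ℓ ≤ n by omega), mul_one_div]
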